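/- arXiv:0704.1691 — 2 statements merged into one kernel-verified Lean document; each statement's English description precedes it below -/
import Mathlib

section
/- Fix n ≥ 1 and r ≥ 1. Suppose there exists a symmetric matrix A ∈ SM(n, ℂ) of rank r such that HVC[n] (respectively VC[n]) holds for Δ_A. Then HVC[n] (respectively VC[n]) holds for Δ_B for every symmetric matrix B ∈ SM(n, ℂ) of rank r. -/
open MvPolynomial

noncomputable def Delta {n : ℕ} (A : Matrix (Fin n) (Fin n) ℂ) :
    Module.End ℂ (MvPolynomial (Fin n) ℂ) :=
  ∑ i, ∑ j, A i j • ((pderiv i).toLinearMap ∘ₗ (pderiv j).toLinearMap)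

/-- `P` is `Λ`-nilpotent: `Λ^m(P^m) = 0` for all `m ≥ 1`. -/
def LNil {n : ℕ} (Λ : Module.End ℂ (MvPolynomial (Fin n) ℂ))
    (P : MvPolynomial (Fin n) ℂ) : Prop :=
  ∀ m : ℕ, 1 ≤ m → (Λ ^ m) (P ^ m) = 0

/-- The Vanishing Conjecture holds for `Λ`. -/
def VC {n : ℕ} (Λ : Module.End ℂ (MvPolynomial (Fin n) ℂ)) : Prop :=
  ∀ P : MvPolynomial (Fin n) ℂ, LNil Λ P →
    ∃ N : ℕ, ∀ m : ℕ, N ≤ m → (Λ ^ m) (P ^ (m + 1)) = 0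

/-- The homogeneous Vanishing Conjecture holds for `Λ`. -/
def HVC {n : ℕ} (Λ : Module.End ℂ (MvPolynomial (Fin n) ℂ)) : Prop :=
  ∀ P : MvPolynomial (Fin n) ℂ, (∃ d : ℕ, P.IsHomogeneous d) → LNil Λ P →
    ∃ N : ℕ, ∀ m : ℕ, N ≤ m → (Λ ^ m) (P ^ (m + 1)) = 0

/-- The linear change of variables sending `X i` to `∑ j, P i j • X j`. -/
noncomputable def linSubst {n : ℕ} (P : Matrix (Fin n) (Fin n) ℂ) :
    MvPolynomial (Fin n) ℂ →ₐ[ℂ] MvPolynomial (Fin n) ℂ :=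
  aeval fun i => ∑ j, P i j • X j

theorem linSubst_X {n : ℕ} (P : Matrix (Fin n) (Fin n) ℂ) (i : Fin n) :
    linSubst P (X i) = ∑ j, P i j • X j := by
  simp [linSubst]

theorem linSubst_mul_apply {n : ℕ} (P Q : Matrix (Fin n) (Fin n) ℂ)
    (f : MvPolynomial (Fin n) ℂ) : linSubst (P * Q) f = linSubst Q (linSubst P f) := by
  suffices h : linSubst (P * Q) = (linSubst Q).comp (linSubst P) from DFunLike.congr_fun h f
  ext1 i
  simp only [AlgHom.comp_apply, linSubst_X, map_sum, map_smul, Matrix.mul_apply, Finset.sum_smul,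
    Finset.smul_sum, mul_smul]
  exact Finset.sum_comm

theorem linSubst_one {n : ℕ} : linSubst (1 : Matrix (Fin n) (Fin n) ℂ) = AlgHom.id ℂ _ := by
  ext1 i
  simp [linSubst_X, Matrix.one_apply, ite_smul]

theorem linSubst_injective {n : ℕ} {P : Matrix (Fin n) (Fin n) ℂ} (hP : IsUnit P) :
    Function.Injective (linSubst P) := by
  obtain ⟨Q, hQ⟩ := hP.exists_right_inv
  refine Function.LeftInverse.injective (g := linSubst Q) fun f => ?_
  rw [← linSubst_mul_apply, hQ, linSubst_one, AlgHom.id_apply]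

theorem MvPolynomial.IsHomogeneous.linSubst {n d : ℕ} {f : MvPolynomial (Fin n) ℂ}
    (hf : f.IsHomogeneous d) (P : Matrix (Fin n) (Fin n) ℂ) :
    (linSubst P f).IsHomogeneous d := by
  have h := hf.aeval (S := ℂ) (n := 1) (fun i => ∑ j, P i j • (X j : MvPolynomial (Fin n) ℂ))
    fun i => IsHomogeneous.sum _ _ _ fun j _ => by
      rw [smul_eq_C_mul]
      exact (isHomogeneous_X ℂ j).C_mul _
  rwa [one_mul] at h

theorem pderiv_linSubst {n : ℕ} (P : Matrix (Fin n) (Fin n) ℂ) (j : Fin n)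
    (f : MvPolynomial (Fin n) ℂ) :
    pderiv j (linSubst P f) = ∑ k, P k j • linSubst P (pderiv k f) := by
  induction f using MvPolynomial.induction_on with
  | C a => simp [linSubst]
  | add p q hp hq => simp [hp, hq, Finset.sum_add_distrib]
  | mul_X p i hp =>
    have hX : pderiv j (linSubst P (X i)) = C (P i j) := by
      simp [linSubst_X, pderiv_X, Pi.single_apply, smul_eq_C_mul]
    simp only [map_mul, Derivation.leibniz, hX, hp, map_add, smul_eq_mul, pderiv_X,
      Pi.single_apply, smul_add, Finset.sum_add_distrib, smul_eq_C_mul, Finset.mul_sum,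
      apply_ite (linSubst P), map_zero, mul_ite, mul_one, mul_zero,
      Finset.sum_ite_eq, Finset.mem_univ, if_true]
    congr 1
    · ring
    · exact Finset.sum_congr rfl fun _ _ => by ring

theorem Delta_apply {n : ℕ} (A : Matrix (Fin n) (Fin n) ℂ) (f : MvPolynomial (Fin n) ℂ) :
    Delta A f = ∑ i, ∑ j, A i j • pderiv i (pderiv j f) := by
  simp [Delta, LinearMap.sum_apply]

theorem Fintype.sum_sum_sum_sum_reverse {ι M : Type*} [Fintype ι] [AddCommMonoid M]
    (F : ι → ι → ι → ι → M) :
    ∑ i, ∑ j, ∑ k, ∑ l, F i j k l = ∑ l, ∑ k, ∑ j, ∑ i, F i j k l := by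
  calc ∑ i, ∑ j, ∑ k, ∑ l, F i j k l = ∑ i, ∑ l, ∑ j, ∑ k, F i j k l :=
        Finset.sum_congr rfl fun i _ =>
          (Finset.sum_congr rfl fun j _ => Finset.sum_comm).trans Finset.sum_comm
    _ = ∑ l, ∑ i, ∑ k, ∑ j, F i j k l :=
        Finset.sum_comm.trans <| Finset.sum_congr rfl fun l _ =>
          Finset.sum_congr rfl fun i _ => Finset.sum_comm
    _ = ∑ l, ∑ k, ∑ j, ∑ i, F i j k l :=
        Finset.sum_congr rfl fun l _ =>
          Finset.sum_comm.trans <| Finset.sum_congr rfl fun k _ => Finset.sum_comm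

theorem Delta_linSubst {n : ℕ} (A P : Matrix (Fin n) (Fin n) ℂ) (f : MvPolynomial (Fin n) ℂ) :
    Delta A (linSubst P f) = linSubst P (Delta (P * A * P.transpose) f) := by
  simp only [Delta_apply, pderiv_linSubst, map_sum, map_smul, Derivation.map_smul, Matrix.mul_apply,
    Matrix.transpose_apply, Finset.smul_sum, Finset.sum_smul, Finset.sum_mul, smul_smul]
  refine (Fintype.sum_sum_sum_sum_reverse _).trans ?_
  refine Finset.sum_congr rfl fun l _ => Finset.sum_congr rfl fun k _ =>
    Finset.sum_congr rfl fun j _ => Finset.sum_congr rfl fun i _ => ?_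
  congr 1
  ring

theorem Delta_pow_linSubst {n : ℕ} (A P : Matrix (Fin n) (Fin n) ℂ) (m : ℕ)
    (f : MvPolynomial (Fin n) ℂ) :
    (Delta A ^ m) (linSubst P f) = linSubst P ((Delta (P * A * P.transpose) ^ m) f) := by
  induction m generalizing f with
  | zero => rfl
  | succ m ih => simp only [pow_succ, Module.End.mul_apply, Delta_linSubst, ih]

/-- Two square matrices are congruent if `B = P * A * Pᵀ` for some invertible `P`. -/
def Matrix.IsCongruent {n : ℕ} (A B : Matrix (Fin n) (Fin n) ℂ) : Prop :=
  ∃ P : Matrix (Fin n) (Fin n) ℂ, IsUnit P ∧ P * A * P.transpose = B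

namespace Matrix.IsCongruent

variable {n : ℕ} {A B D : Matrix (Fin n) (Fin n) ℂ}

theorem trans (h : A.IsCongruent B) (h' : B.IsCongruent D) : A.IsCongruent D := by
  obtain ⟨P, hP, rfl⟩ := h
  obtain ⟨Q, hQ, rfl⟩ := h'
  exact ⟨Q * P, hQ.mul hP, by simp only [Matrix.transpose_mul, Matrix.mul_assoc]⟩

theorem symm (h : A.IsCongruent B) : B.IsCongruent A := by
  obtain ⟨P, hP, rfl⟩ := h
  obtain ⟨Q, hPQ, hQP⟩ := isUnit_iff_exists.1 hP
  refine ⟨Q, isUnit_iff_exists.2 ⟨P, hQP, hPQ⟩, ?_⟩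
  calc Q * (P * A * P.transpose) * Q.transpose = (Q * P) * A * (Q * P).transpose := by
        simp only [Matrix.transpose_mul, Matrix.mul_assoc]
    _ = A := by simp [hQP]

theorem rank_eq (h : A.IsCongruent B) : A.rank = B.rank := by
  obtain ⟨P, hP, rfl⟩ := h
  have hd : IsUnit P.det := (Matrix.isUnit_iff_isUnit_det P).1 hP
  rw [Matrix.rank_mul_eq_left_of_isUnit_det _ _ (by rwa [Matrix.det_transpose]),
    Matrix.rank_mul_eq_right_of_isUnit_det _ _ hd]

/-- On a class of polynomials stable under linear substitutions, the vanishing property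
is invariant under congruence. -/
theorem vanishing (h : A.IsCongruent B) {S : Set (MvPolynomial (Fin n) ℂ)}
    (hS : ∀ P, ∀ f ∈ S, linSubst P f ∈ S)
    (hA : ∀ f ∈ S, LNil (Delta A) f → ∃ N : ℕ, ∀ m : ℕ, N ≤ m → (Delta A ^ m) (f ^ (m + 1)) = 0) :
    ∀ f ∈ S, LNil (Delta B) f → ∃ N : ℕ, ∀ m : ℕ, N ≤ m → (Delta B ^ m) (f ^ (m + 1)) = 0 := by
  obtain ⟨P, hP, rfl⟩ := h
  intro f hf hnil
  obtain ⟨N, hN⟩ := hA (linSubst P f) (hS P f hf) fun m hm => by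
    rw [← map_pow, Delta_pow_linSubst, hnil m hm, map_zero]
  refine ⟨N, fun m hm => linSubst_injective hP ?_⟩
  rw [← Delta_pow_linSubst, map_pow, hN m hm, map_zero]

theorem vc (h : A.IsCongruent B) (hA : VC (Delta A)) : VC (Delta B) := fun f =>
  h.vanishing (S := Set.univ) (fun _ _ _ => trivial) (fun f _ => hA f) f trivial

theorem hvc (h : A.IsCongruent B) (hA : HVC (Delta A)) : HVC (Delta B) :=
  h.vanishing (S := {f | ∃ d : ℕ, f.IsHomogeneous d})
    (fun P _ ⟨d, hd⟩ => ⟨d, hd.linSubst P⟩) hA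

theorem exists_diagonal (hA : A.IsSymm) :
    ∃ w : Fin n → ℂ, A.IsCongruent (Matrix.diagonal w) := by
  have : Invertible (2 : ℂ) := invertibleOfNonzero two_ne_zero
  obtain ⟨v, hv⟩ := LinearMap.BilinForm.exists_orthogonal_basis
    (LinearMap.BilinForm.isSymm_iff.1 (Matrix.isSymm_toBilin'_iff_isSymm.2 hA))
  have hn : Module.finrank ℂ (Fin n → ℂ) = n := by simp
  let b := v.reindex (finCongr hn)
  let P : Matrix (Fin n) (Fin n) ℂ := Matrix.of fun i => b i
  refine ⟨fun i => (P * A * P.transpose) i i, P,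
    Matrix.linearIndependent_rows_iff_isUnit.1 b.linearIndependent, ?_⟩
  have key : ∀ i j, (P * A * P.transpose) i j = A.toBilin' (b i) (b j) := fun i j => by
    rw [Matrix.toBilin'_apply', Matrix.mul_assoc]
    simp [Matrix.mul_apply, dotProduct, Matrix.mulVec, P]
  ext i j
  rcases eq_or_ne i j with rfl | hij
  · simp
  · rw [Matrix.diagonal_apply_ne _ hij, key]
    simpa [b] using hv (i := (finCongr hn).symm i) (j := (finCongr hn).symm j) (by simpa using hij)

theorem diagonal_indicator (w : Fin n → ℂ) :
    (Matrix.diagonal w).IsCongruent (Matrix.diagonal fun i => if w i = 0 then 0 else 1) := by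
  choose s hs using fun i => IsAlgClosed.exists_pow_nat_eq (w i) two_pos
  refine ⟨Matrix.diagonal fun i => if w i = 0 then 1 else (s i)⁻¹, ?_, ?_⟩
  · rw [Matrix.isUnit_iff_isUnit_det, Matrix.det_diagonal, isUnit_iff_ne_zero,
      Finset.prod_ne_zero_iff]
    intro i _
    split_ifs with h
    · exact one_ne_zero
    · exact inv_ne_zero fun h0 => h (by rw [← hs i, h0]; simp)
  · rw [Matrix.diagonal_transpose, Matrix.diagonal_mul_diagonal, Matrix.diagonal_mul_diagonal]
    congr 1
    ext1 i
    split_ifs with h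
    · simp [h]
    · have h0 : s i ≠ 0 := fun h0 => h (by rw [← hs i, h0]; simp)
      rw [← hs i]
      field_simp

theorem diagonal_perm (w : Fin n → ℂ) (σ : Equiv.Perm (Fin n)) :
    (Matrix.diagonal w).IsCongruent (Matrix.diagonal (w ∘ σ)) := by
  refine ⟨(1 : Matrix (Fin n) (Fin n) ℂ).submatrix σ id, ?_, ?_⟩
  · rw [Matrix.isUnit_iff_isUnit_det, Matrix.det_permute, Matrix.det_one, mul_one]
    rcases Int.units_eq_one_or (Equiv.Perm.sign σ) with h | h <;> simp [h]
  · ext i j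
    simp [Matrix.mul_apply, Matrix.one_apply, Matrix.diagonal_apply]
    split_ifs with h <;> simp [h]

/-- Complex symmetric matrices of equal rank are congruent. -/
theorem of_rank_eq (hA : A.IsSymm) (hB : B.IsSymm) (h : A.rank = B.rank) :
    A.IsCongruent B := by
  obtain ⟨w, hw⟩ := exists_diagonal hA
  obtain ⟨w', hw'⟩ := exists_diagonal hB
  have hcard : Fintype.card {i // w' i ≠ 0} = Fintype.card {i // w i ≠ 0} := by
    rw [← Matrix.rank_diagonal, ← Matrix.rank_diagonal, ← hw.rank_eq, ← hw'.rank_eq, h]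
  let e := Fintype.equivOfCardEq hcard
  have hσ := diagonal_perm (fun i => if w i = 0 then 0 else 1) e.extendSubtype
  have heq : (fun i => if w i = 0 then (0 : ℂ) else 1) ∘ e.extendSubtype =
      fun i => if w' i = 0 then 0 else 1 := by
    ext1 i
    by_cases hi : w' i = 0
    · have := e.extendSubtype_not_mem i (not_not.2 hi)
      simp [hi, not_not.1 this]
    · have := e.extendSubtype_mem i hi
      simp [hi, this]
  rw [heq] at hσ
  exact (hw.trans ((diagonal_indicator w).trans hσ)).trans
    (hw'.trans (diagonal_indicator w')).symm

end Matrix.IsCongruent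

/-- If `HVC[n]` (resp. `VC[n]`) holds for `Δ_A` for some symmetric `A` of rank `r`,
then it holds for `Δ_B` for every symmetric `B` of rank `r`. -/
theorem stmt2 {n r : ℕ} (hn : 1 ≤ n) (hr : 1 ≤ r) :
    ((∃ A : Matrix (Fin n) (Fin n) ℂ, A.IsSymm ∧ A.rank = r ∧ HVC (Delta A)) →
      ∀ B : Matrix (Fin n) (Fin n) ℂ, B.IsSymm → B.rank = r → HVC (Delta B)) ∧
    ((∃ A : Matrix (Fin n) (Fin n) ℂ, A.IsSymm ∧ A.rank = r ∧ VC (Delta A)) →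
      ∀ B : Matrix (Fin n) (Fin n) ℂ, B.IsSymm → B.rank = r → VC (Delta B)) := by
  constructor
  · rintro ⟨A, hA, hAr, h⟩ B hB hBr
    exact (Matrix.IsCongruent.of_rank_eq hA hB (hAr.trans hBr.symm)).hvc h
  · rintro ⟨A, hA, hAr, h⟩ B hB hBr
    exact (Matrix.IsCongruent.of_rank_eq hA hB (hAr.trans hBr.symm)).vc h
end

section
/- Let A ∈ SM(n, ℂ) be invertible and let P ∈ ℂ[z_1, …, z_n] be homogeneous of degree d ≥ 2. Then P is Δ_A-nilpotent if and only if for every β ∈ ℂ^n the polynomial (β_D)^{d-2} P is Δ_A-nilpotent, where β_D := Σ_{i=1}^n β_i D_i. -/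
open MvPolynomial

/-- The first-order constant-coefficient operator `β_D = Σ βᵢ Dᵢ`. -/
noncomputable def betaD {n : ℕ} (β : Fin n → ℂ) : Module.End ℂ (MvPolynomial (Fin n) ℂ) :=
  ∑ i, β i • (pderiv i).toLinearMap

section Laplacian

variable {ι S : Type*} [Fintype ι] [CommRing S] [Algebra ℂ S]

/-- The second-order operator `∑ aᵢⱼ Dᵢ Dⱼ` attached to a family of derivations. -/
noncomputable def laplacian (a : Matrix ι ι ℂ) (D : ι → Derivation ℂ S S) : Module.End ℂ S :=
  ∑ i, ∑ j, a i j • ((D i).toLinearMap ∘ₗ (D j).toLinearMap)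

/-- The bilinear form `∑ aᵢⱼ (Dᵢ f) (Dⱼ g)`. -/
noncomputable def gradForm (a : Matrix ι ι ℂ) (D : ι → Derivation ℂ S S) (f g : S) : S :=
  ∑ i, ∑ j, a i j • (D i f * D j g)

/-- The matrix `a · (Dᵢ Dⱼ f)`. -/
noncomputable def hessianMul (a : Matrix ι ι ℂ) (D : ι → Derivation ℂ S S) (f : S) :
    Matrix ι ι S :=
  a.map (algebraMap ℂ S) * Matrix.of fun i j => D i (D j f)

lemma laplacian_apply (a : Matrix ι ι ℂ) (D : ι → Derivation ℂ S S) (f : S) :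
    laplacian a D f = ∑ i, ∑ j, a i j • D i (D j f) := by
  simp [laplacian, LinearMap.sum_apply]

lemma hessianMul_apply (a : Matrix ι ι ℂ) (D : ι → Derivation ℂ S S) (f : S) (k l : ι) :
    hessianMul a D f k l = ∑ i, a k i • D i (D l f) := by
  simp [hessianMul, Matrix.mul_apply, Algebra.smul_def]

lemma trace_hessianMul {a : Matrix ι ι ℂ} (ha : a.IsSymm) (D : ι → Derivation ℂ S S) (f : S) :
    (hessianMul a D f).trace = laplacian a D f := by
  simp only [Matrix.trace, Matrix.diag, hessianMul_apply, laplacian_apply]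
  rw [Finset.sum_comm]
  simp only [ha.apply]

lemma laplacian_pow_succ (a : Matrix ι ι ℂ) (D : ι → Derivation ℂ S S) (T : Derivation ℂ S S)
    {Q : S} (hQ : (2 : ℂ) • T Q = gradForm a D Q Q) (k : ℕ) :
    laplacian a D (Q ^ (k + 1)) =
      (k + 1) • ((2 : ℂ) • T (Q ^ k) + Q ^ k * laplacian a D Q) := by
  have key : (2 : ℂ) • T (Q ^ k) = k • (Q ^ (k - 1) * gradForm a D Q Q) := by
    rw [Derivation.leibniz_pow, ← hQ, smul_comm]
    simp
  rw [key, laplacian_apply, laplacian_apply, gradForm]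
  simp only [Finset.mul_sum, Finset.smul_sum, ← Finset.sum_add_distrib]
  refine Finset.sum_congr rfl fun i _ => Finset.sum_congr rfl fun j _ => ?_
  rw [Derivation.leibniz_pow, map_nsmul]
  simp only [Nat.add_sub_cancel, smul_eq_mul, Derivation.leibniz, Derivation.leibniz_pow,
    ← Nat.cast_smul_eq_nsmul ℂ]
  simp only [Algebra.smul_def]
  ring

lemma derivation_sum_apply (D : ι → Derivation ℂ S S) (f : S) :
    (∑ i, D i) f = ∑ i, D i f := by
  have h := congrFun (map_sum Derivation.coeFnAddMonoidHom D Finset.univ) f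
  rw [Finset.sum_apply] at h
  exact h

/-- Along a solution of the Hamilton–Jacobi equation the matrix `a · Hess` satisfies a
Riccati equation. -/
lemma derivation_hessianMul {a : Matrix ι ι ℂ} (ha : a.IsSymm) (D : ι → Derivation ℂ S S)
    (hD : ∀ i j f, D i (D j f) = D j (D i f)) (T : Derivation ℂ S S)
    (hT : ∀ i f, T (D i f) = D i (T f))
    {Q : S} (hQ : (2 : ℂ) • T Q = gradForm a D Q Q) (k l : ι) :
    (T - ∑ i, (∑ j, a i j • D j Q) • D i) (hessianMul a D Q k l) =
      (hessianMul a D Q * hessianMul a D Q) k l := by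
  have hess (p q : ι) : (T - ∑ i, (∑ j, a i j • D j Q) • D i) (D p (D q Q)) =
      ∑ i, D p (D i Q) * hessianMul a D Q i q := by
    have h2 : (2 : ℂ) • T (D p (D q Q)) = (2 : ℂ) • (∑ i, D p (D i Q) * hessianMul a D Q i q +
        ∑ i, (∑ j, a i j • D j Q) * D i (D p (D q Q))) := by
      rw [hT, hT, ← Derivation.map_smul, ← Derivation.map_smul, hQ, gradForm]
      simp only [map_sum, Derivation.map_smul, Derivation.leibniz, map_add, smul_eq_mul,
        hessianMul_apply, Finset.mul_sum, Finset.sum_mul, two_smul ℂ, smul_add, Finset.sum_add_distrib,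
        mul_smul_comm, smul_mul_assoc]
      have e1 : ∑ i, ∑ j, a i j • (D i Q * D p (D q (D j Q))) =
          ∑ i, ∑ j, a i j • (D j Q * D i (D p (D q Q))) := by
        rw [Finset.sum_comm]
        refine Finset.sum_congr rfl fun i _ => Finset.sum_congr rfl fun j _ => ?_
        rw [ha.apply, hD q i, hD p i]
      have e2 : ∑ i, ∑ j, a i j • (D j Q * D p (D q (D i Q))) =
          ∑ i, ∑ j, a i j • (D j Q * D i (D p (D q Q))) := by
        refine Finset.sum_congr rfl fun i _ => Finset.sum_congr rfl fun j _ => ?_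
        rw [hD q i, hD p i]
      have e3 : ∑ i, ∑ j, a i j • (D q (D j Q) * D p (D i Q)) =
          ∑ i, ∑ j, a i j • (D p (D i Q) * D j (D q Q)) := by
        refine Finset.sum_congr rfl fun i _ => Finset.sum_congr rfl fun j _ => ?_
        rw [hD q j, mul_comm]
      have e4 : ∑ i, ∑ j, a i j • (D q (D i Q) * D p (D j Q)) =
          ∑ i, ∑ j, a i j • (D p (D i Q) * D j (D q Q)) := by
        rw [Finset.sum_comm]
        refine Finset.sum_congr rfl fun i _ => Finset.sum_congr rfl fun j _ => ?_
        rw [ha.apply, hD q j, mul_comm]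
      simp only [e1, e2, e3, e4]
      abel
    have h3 := smul_right_injective S (two_ne_zero' ℂ) h2
    simp only [Derivation.sub_apply, h3, derivation_sum_apply,
      Derivation.smul_apply, smul_eq_mul, add_sub_cancel_right]
  rw [hessianMul_apply, map_sum, Matrix.mul_apply]
  simp only [Derivation.map_smul, hess, hessianMul_apply, Finset.smul_sum, Finset.sum_mul,
    Finset.mul_sum]
  rw [Finset.sum_comm]
  refine Finset.sum_congr rfl fun i _ => ?_
  rw [Finset.sum_comm]
  simp only [smul_mul_assoc]

lemma derivation_matrix_pow [DecidableEq ι] (δ : Derivation ℂ S S) {M : Matrix ι ι S}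
    (hM : ∀ k l, δ (M k l) = (M * M) k l) (m : ℕ) (k l : ι) :
    δ ((M ^ m) k l) = m • (M ^ (m + 1)) k l := by
  induction m generalizing k l with
  | zero =>
    simp only [pow_zero, Matrix.one_apply, zero_smul]
    split_ifs <;> simp
  | succ m ih =>
    rw [pow_succ, Matrix.mul_apply, map_sum]
    simp only [Derivation.leibniz, ih, hM, smul_eq_mul, Finset.sum_add_distrib]
    rw [← Matrix.mul_apply, ← mul_assoc, ← pow_succ, ← pow_succ]
    have : ∑ x, M x l * m • (M ^ (m + 1)) k x = m • (M ^ (m + 1) * M) k l := by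
      rw [Matrix.mul_apply, Finset.smul_sum]
      refine Finset.sum_congr rfl fun x _ => ?_
      rw [mul_smul_comm, mul_comm]
    rw [this, ← pow_succ, succ_nsmul, add_comm]

lemma derivation_trace_pow [DecidableEq ι] (δ : Derivation ℂ S S) {M : Matrix ι ι S}
    (hM : ∀ k l, δ (M k l) = (M * M) k l) (m : ℕ) :
    δ (M ^ m).trace = m • (M ^ (m + 1)).trace := by
  simp only [Matrix.trace, Matrix.diag, map_sum, derivation_matrix_pow δ hM, Finset.smul_sum]

end Laplacian

section PowerSeries

open PowerSeries

variable {ι R : Type*} [Fintype ι] [CommRing R] [Algebra ℂ R]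

/-- The coefficientwise extension of a derivation to power series. -/
noncomputable def coeffwiseDerivation (d : Derivation ℂ R R) :
    Derivation ℂ (PowerSeries R) (PowerSeries R) :=
  Derivation.mk'
    { toFun := fun f => PowerSeries.mk fun m => d (coeff m f)
      map_add' := fun f g => by ext; simp
      map_smul' := fun c f => by ext; simp }
    fun f g => by
      ext m
      simp only [LinearMap.coe_mk, AddHom.coe_mk, coeff_mk, PowerSeries.coeff_mul, map_sum, map_add,
        Derivation.leibniz, smul_eq_mul, Finset.sum_add_distrib]
      congr 1
      rw [← Finset.Nat.sum_antidiagonal_swap]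
      rfl

@[simp]
lemma coeff_coeffwiseDerivation (d : Derivation ℂ R R) (m : ℕ) (f : PowerSeries R) :
    coeff m (coeffwiseDerivation d f) = d (coeff m f) := by
  simp [coeffwiseDerivation]

/-- Differentiation with respect to the power series variable, as a `ℂ`-derivation. -/
noncomputable def timeDerivation : Derivation ℂ (PowerSeries R) (PowerSeries R) :=
  (PowerSeries.derivative R).restrictScalars ℂ

@[simp]
lemma coeff_timeDerivation (f : PowerSeries R) (m : ℕ) :
    coeff m (timeDerivation f) = (m + 1) • coeff (m + 1) f := by
  change coeff m (PowerSeries.derivative R f) = _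
  rw [coeff_derivative, nsmul_eq_mul, mul_comm]
  push_cast
  rfl

lemma coeff_laplacian (a : Matrix ι ι ℂ) (D : ι → Derivation ℂ R R) (m : ℕ)
    (f : PowerSeries R) :
    coeff m (laplacian a (fun i => coeffwiseDerivation (D i)) f) =
      laplacian a D (coeff m f) := by
  simp [laplacian_apply]

lemma timeDerivation_coeffwiseDerivation (d : Derivation ℂ R R) (f : PowerSeries R) :
    timeDerivation (coeffwiseDerivation d f) = coeffwiseDerivation d (timeDerivation f) := by
  ext m
  simp

/-- The coefficients of the solution of `2 ∂ₜ Q = ∑ aᵢⱼ (Dᵢ Q) (Dⱼ Q)` with initial value `P`. -/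
noncomputable def hamiltonJacobiCoeff (a : Matrix ι ι ℂ) (D : ι → Derivation ℂ R R) (P : R) :
    ℕ → R
  | 0 => P
  | m + 1 => (2 * (m + 1 : ℂ))⁻¹ • ∑ p : Fin (m + 1),
      gradForm a D (hamiltonJacobiCoeff a D P p) (hamiltonJacobiCoeff a D P (m - p))
  decreasing_by all_goals omega

lemma exists_hamiltonJacobi (a : Matrix ι ι ℂ) (D : ι → Derivation ℂ R R) (P : R) :
    ∃ Q : PowerSeries R, coeff 0 Q = P ∧
      (2 : ℂ) • timeDerivation Q = gradForm a (fun i => coeffwiseDerivation (D i)) Q Q := by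
  refine ⟨PowerSeries.mk (hamiltonJacobiCoeff a D P), by simp [hamiltonJacobiCoeff], ?_⟩
  ext m
  have hm : (m + 1 : ℂ) ≠ 0 := by exact_mod_cast m.succ_ne_zero
  have hsum : coeff m (gradForm a (fun i => coeffwiseDerivation (D i))
        (PowerSeries.mk (hamiltonJacobiCoeff a D P))
        (PowerSeries.mk (hamiltonJacobiCoeff a D P))) =
      ∑ p : Fin (m + 1), gradForm a D (hamiltonJacobiCoeff a D P p)
        (hamiltonJacobiCoeff a D P (m - p)) := by
    rw [Fin.sum_univ_eq_sum_range (fun p => gradForm a D (hamiltonJacobiCoeff a D P p)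
        (hamiltonJacobiCoeff a D P (m - p))),
      ← Finset.Nat.sum_antidiagonal_eq_sum_range_succ (fun p q => gradForm a D
        (hamiltonJacobiCoeff a D P p) (hamiltonJacobiCoeff a D P q))]
    simp only [gradForm, map_sum, PowerSeries.coeff_smul, PowerSeries.coeff_mul,
      coeff_coeffwiseDerivation, coeff_mk]
    rw [Finset.sum_comm]
    simp only [Finset.smul_sum]
    rw [Finset.sum_comm]
    refine (Finset.sum_congr rfl fun i _ => Finset.sum_comm).trans ?_
    rw [Finset.sum_comm]
  rw [hsum, PowerSeries.coeff_smul, coeff_timeDerivation, coeff_mk, hamiltonJacobiCoeff,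
    ← Nat.cast_smul_eq_nsmul ℂ, smul_smul, smul_smul]
  push_cast
  rw [mul_inv_cancel₀ (mul_ne_zero two_ne_zero hm), one_smul]

lemma nsmul_eq_zero_iff_of_ne_zero {c : ℕ} (hc : c ≠ 0) {x : R} : c • x = 0 ↔ x = 0 := by
  rw [← Nat.cast_smul_eq_nsmul ℂ, smul_eq_zero, Nat.cast_eq_zero, or_iff_right hc]

lemma exists_coeff_laplacian_pow (a : Matrix ι ι ℂ) (D : ι → Derivation ℂ R R)
    {Q : PowerSeries R}
    (hQ : (2 : ℂ) • timeDerivation Q = gradForm a (fun i => coeffwiseDerivation (D i)) Q Q)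
    {r : ℕ} (hr : ∀ i < r, laplacian a D (coeff i Q) = 0) (j k : ℕ) :
    ∀ i, i + j ≤ r → ∃ c : ℕ, c ≠ 0 ∧
      (laplacian a D ^ j) (coeff i (Q ^ (k + j))) = c • coeff (i + j) (Q ^ k) := by
  induction j generalizing k with
  | zero => exact fun i _ => ⟨1, one_ne_zero, by simp⟩
  | succ j ih =>
    intro i hi
    obtain ⟨c, hc, h⟩ := ih (k + 1) i (by omega)
    refine ⟨c * ((k + 1) * (2 * (i + j + 1))), by positivity, ?_⟩
    have hzero : coeff (i + j)
        (Q ^ k * laplacian a (fun i => coeffwiseDerivation (D i)) Q) = 0 := by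
      rw [PowerSeries.coeff_mul]
      refine Finset.sum_eq_zero fun p hp => ?_
      rw [coeff_laplacian, hr, mul_zero]
      have := Finset.HasAntidiagonal.mem_antidiagonal.mp hp
      omega
    rw [pow_succ', Module.End.mul_apply, show k + (j + 1) = k + 1 + j by ring, h, map_nsmul,
      ← coeff_laplacian, laplacian_pow_succ a _ timeDerivation hQ, map_nsmul, map_add, hzero,
      add_zero, PowerSeries.coeff_smul, coeff_timeDerivation, two_smul ℂ, ← two_nsmul,
      smul_smul, smul_smul, smul_smul, mul_assoc, mul_assoc, add_assoc i j 1]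

lemma laplacian_pow_eq_zero_iff (a : Matrix ι ι ℂ) (D : ι → Derivation ℂ R R)
    {Q : PowerSeries R}
    (hQ : (2 : ℂ) • timeDerivation Q = gradForm a (fun i => coeffwiseDerivation (D i)) Q Q) :
    (∀ m, 1 ≤ m → (laplacian a D ^ m) (coeff 0 Q ^ m) = 0) ↔
      ∀ r, laplacian a D (coeff r Q) = 0 := by
  have key (r : ℕ) (hr : ∀ i < r, laplacian a D (coeff i Q) = 0) :
      (laplacian a D ^ (r + 1)) (coeff 0 Q ^ (r + 1)) = 0 ↔ laplacian a D (coeff r Q) = 0 := by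
    obtain ⟨c, hc, h⟩ := exists_coeff_laplacian_pow a D hQ hr r 1 0 (by omega)
    rw [coeff_zero_eq_constantCoeff_apply, ← map_pow, ← coeff_zero_eq_constantCoeff_apply,
      pow_succ', Module.End.mul_apply, add_comm r 1, h, map_nsmul,
      nsmul_eq_zero_iff_of_ne_zero hc, zero_add, pow_one]
  constructor
  · intro h r
    induction r using Nat.strong_induction_on with
    | _ r ih => exact (key r ih).1 (h _ (by omega))
  · rintro h (_ | m) hm
    · omega
    · exact (key m fun i _ => h i).2 (h m)

lemma constantCoeff_trace_hessianMul_pow [DecidableEq ι] (a : Matrix ι ι ℂ)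
    (D : ι → Derivation ℂ R R) (Q : PowerSeries R) (m : ℕ) :
    constantCoeff (hessianMul a (fun i => coeffwiseDerivation (D i)) Q ^ m).trace =
      (hessianMul a D (coeff 0 Q) ^ m).trace := by
  rw [AddMonoidHom.map_trace, ← RingHom.mapMatrix_apply, map_pow]
  congr 2
  ext k l
  rw [RingHom.mapMatrix_apply, Matrix.map_apply, ← coeff_zero_eq_constantCoeff_apply]
  simp [hessianMul_apply]

lemma coeff_laplacian_eq_zero_iff [DecidableEq ι] {a : Matrix ι ι ℂ} (ha : a.IsSymm)
    (D : ι → Derivation ℂ R R) (hD : ∀ i j f, D i (D j f) = D j (D i f)) {Q : PowerSeries R}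
    (hQ : (2 : ℂ) • timeDerivation Q = gradForm a (fun i => coeffwiseDerivation (D i)) Q Q) :
    (∀ r, laplacian a D (coeff r Q) = 0) ↔
      ∀ m, 1 ≤ m → (hessianMul a D (coeff 0 Q) ^ m).trace = 0 := by
  set D' := fun i => coeffwiseDerivation (D i) with hD'
  set M := hessianMul a D' Q with hM
  have riccati := derivation_trace_pow _ (derivation_hessianMul ha D'
    (fun i j f => by ext; simp [hD', hD (j := j) (i := i)]) timeDerivation
    (fun i f => timeDerivation_coeffwiseDerivation (D i) f) hQ)
  rw [← hM] at riccati
  constructor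
  · intro h
    have htrace (m : ℕ) : (M ^ (m + 1)).trace = 0 := by
      induction m with
      | zero =>
        rw [zero_add, pow_one, hM, trace_hessianMul ha]
        ext r
        rw [hD', coeff_laplacian, h, map_zero]
      | succ m ih =>
        have := riccati (m + 1)
        rw [ih, map_zero] at this
        exact (nsmul_eq_zero_iff_of_ne_zero m.succ_ne_zero).1 this.symm
    rintro (_ | m) hm
    · omega
    · rw [← constantCoeff_trace_hessianMul_pow, ← hM, htrace, map_zero]
  · intro h r
    have hcoeff (r : ℕ) : ∀ m, 1 ≤ m → coeff r (M ^ m).trace = 0 := by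
      induction r using Nat.strong_induction_on with
      | _ r ih =>
        intro m hm
        obtain _ | r := r
        · rw [coeff_zero_eq_constantCoeff_apply, hM, constantCoeff_trace_hessianMul_pow, h m hm]
        · have h1 := congrArg (coeff r) (riccati m)
          rw [map_nsmul, ih r r.lt_succ_self _ (by omega), smul_zero, Derivation.sub_apply, map_sub,
            coeff_timeDerivation, derivation_sum_apply, map_sum, Finset.sum_eq_zero, sub_zero] at h1
          · exact (nsmul_eq_zero_iff_of_ne_zero r.succ_ne_zero).1 h1
          · intro i _
            rw [Derivation.smul_apply, smul_eq_mul, PowerSeries.coeff_mul]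
            refine Finset.sum_eq_zero fun p hp => ?_
            have := Finset.HasAntidiagonal.mem_antidiagonal.mp hp
            rw [hD', coeff_coeffwiseDerivation, ih p.2 (by omega) m hm, map_zero, mul_zero]
    rw [← coeff_laplacian, ← hD', ← trace_hessianMul ha, ← hM, ← pow_one M]
    exact hcoeff r 1 le_rfl

/-- `Δ^m (P^m)` vanishes for all `m ≥ 1` exactly when all power traces of the Hessian vanish. -/
theorem laplacian_nilpotent_iff_trace [DecidableEq ι] {a : Matrix ι ι ℂ} (ha : a.IsSymm)
    (D : ι → Derivation ℂ R R) (hD : ∀ i j f, D i (D j f) = D j (D i f)) (P : R) :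
    (∀ m, 1 ≤ m → (laplacian a D ^ m) (P ^ m) = 0) ↔
      ∀ m, 1 ≤ m → (hessianMul a D P ^ m).trace = 0 := by
  obtain ⟨Q, rfl, hQ⟩ := exists_hamiltonJacobi a D P
  rw [laplacian_pow_eq_zero_iff a D hQ, coeff_laplacian_eq_zero_iff ha D hD hQ]

end PowerSeries

section Polynomial

variable {n : ℕ}

lemma pderiv_comm (i j : Fin n) (f : MvPolynomial (Fin n) ℂ) :
    pderiv i (pderiv j f) = pderiv j (pderiv i f) := by
  have h : ⁅(pderiv i : Derivation ℂ (MvPolynomial (Fin n) ℂ) (MvPolynomial (Fin n) ℂ)),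
      (pderiv j : Derivation ℂ (MvPolynomial (Fin n) ℂ) (MvPolynomial (Fin n) ℂ))⁆ = 0 := by
    refine MvPolynomial.derivation_ext fun k => ?_
    simp [Derivation.commutator_apply, pderiv_X, Pi.single_apply, apply_ite]
  have h' := DFunLike.congr_fun h f
  rwa [Derivation.commutator_apply, Derivation.zero_apply, sub_eq_zero] at h'

lemma lNil_iff_trace {A : Matrix (Fin n) (Fin n) ℂ} (hA : A.IsSymm)
    (P : MvPolynomial (Fin n) ℂ) :
    LNil (Delta A) P ↔ ∀ m, 1 ≤ m → (hessianMul A (fun i => pderiv i) P ^ m).trace = 0 :=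
  laplacian_nilpotent_iff_trace hA _ pderiv_comm P

lemma betaD_apply (β : Fin n → ℂ) (f : MvPolynomial (Fin n) ℂ) :
    betaD β f = ∑ i, β i • pderiv i f := by
  simp [betaD, LinearMap.sum_apply]

lemma pderiv_betaD_pow (β : Fin n → ℂ) (i : Fin n) (m : ℕ) (f : MvPolynomial (Fin n) ℂ) :
    pderiv i ((betaD β ^ m) f) = (betaD β ^ m) (pderiv i f) := by
  induction m with
  | zero => rfl
  | succ m ih =>
    rw [pow_succ', Module.End.mul_apply, Module.End.mul_apply, ← ih, betaD_apply, betaD_apply,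
      map_sum]
    exact Finset.sum_congr rfl fun j _ => by rw [Derivation.map_smul, pderiv_comm]

lemma betaD_pow_of_isHomogeneous (β : Fin n → ℂ) {m : ℕ} {f : MvPolynomial (Fin n) ℂ}
    (hf : f.IsHomogeneous m) :
    (betaD β ^ m) f = C (m.factorial * eval β f) := by
  induction m generalizing f with
  | zero =>
    obtain ⟨c, rfl⟩ : ∃ c, f = C c :=
      ⟨_, totalDegree_eq_zero_iff_eq_C.1 (Nat.le_zero.1 hf.totalDegree_le)⟩
    simp
  | succ m ih =>
    have hhom : (betaD β f).IsHomogeneous m := by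
      rw [betaD_apply]
      refine IsHomogeneous.sum _ _ _ fun i _ => ?_
      rw [smul_eq_C_mul]
      simpa using (isHomogeneous_C (Fin n) (β i)).mul (hf.pderiv (i := i))
    have heuler := congrArg (eval β) hf.sum_X_mul_pderiv
    rw [pow_succ, Module.End.mul_apply, ih hhom, betaD_apply, Nat.factorial_succ]
    simp only [map_sum, map_mul (eval β), eval_X, smul_eval, nsmul_eq_mul, map_natCast] at heuler ⊢
    rw [heuler]
    congr 1
    push_cast
    ring

lemma trace_hessianMul_betaD_pow (A : Matrix (Fin n) (Fin n) ℂ) {d : ℕ} (β : Fin n → ℂ)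
    {P : MvPolynomial (Fin n) ℂ} (hP : P.IsHomogeneous d) (m : ℕ) :
    (hessianMul A (fun i => pderiv i) ((betaD β ^ (d - 2)) P) ^ m).trace =
      C (((d - 2).factorial : ℂ) ^ m *
        eval β (hessianMul A (fun i => pderiv i) P ^ m).trace) := by
  have hhess : hessianMul A (fun i => pderiv i) ((betaD β ^ (d - 2)) P) =
      (C.comp (eval β)).mapMatrix
        (((d - 2).factorial : ℂ) • hessianMul A (fun i => pderiv i) P) := by
    ext1 k l
    rw [RingHom.mapMatrix_apply, Matrix.map_apply, Matrix.smul_apply, hessianMul_apply,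
      hessianMul_apply, Finset.smul_sum, map_sum]
    refine Finset.sum_congr rfl fun i _ => ?_
    have hh : (pderiv i (pderiv l P)).IsHomogeneous (d - 2) := (hP.pderiv).pderiv
    rw [pderiv_betaD_pow, pderiv_betaD_pow, betaD_pow_of_isHomogeneous β hh]
    simp only [RingHom.comp_apply, smul_eq_C_mul, map_mul, eval_C]
    ring
  rw [hhess, ← map_pow, RingHom.mapMatrix_apply, ← AddMonoidHom.map_trace, smul_pow,
    Matrix.trace_smul, RingHom.comp_apply, smul_eval]

end Polynomial

/-- For invertible symmetric `A` and homogeneous `P` of degree `d ≥ 2`, `P` is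
`Δ_A`-nilpotent iff `(β_D)^{d-2} P` is `Δ_A`-nilpotent for all `β ∈ ℂⁿ`. -/
theorem stmt11 {n : ℕ} (A : Matrix (Fin n) (Fin n) ℂ) (hA : A.IsSymm) (hAu : IsUnit A)
    {d : ℕ} (hd : 2 ≤ d) (P : MvPolynomial (Fin n) ℂ) (hP : P.IsHomogeneous d) :
    LNil (Delta A) P ↔ ∀ β : Fin n → ℂ, LNil (Delta A) (((betaD β) ^ (d - 2)) P) := by
  have hfact (m : ℕ) : ((d - 2).factorial : ℂ) ^ m ≠ 0 :=
    pow_ne_zero _ (Nat.cast_ne_zero.2 (Nat.factorial_ne_zero _))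
  simp only [lNil_iff_trace hA, trace_hessianMul_betaD_pow A _ hP, C_eq_zero, mul_eq_zero,
    or_iff_right (hfact _)]
  constructor
  · intro h β m hm
    rw [h m hm, map_zero]
  · intro h m hm
    exact MvPolynomial.funext fun β => by rw [h β m hm, map_zero]
end
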